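/- arXiv:1105.3095 — 2 statements merged into one kernel-verified Lean document; each statement's English description precedes it below -/
import Mathlib

section
/- Set V(t) := β(1/t), D(x) := sup_{t>0} ( t − (t/x)·V(t) ) and D_{g,β}(x) := sup_{u>0} g(u)·(1 − V(u)/x) for x > 0. Then for every x > 0 and every ρ > 1, one has (1 − ρ⁻¹)·g(D(ρ⁻¹ x)) ≤ D_{g,β}(x) ≤ g(D(x)). -/
open Set

/-- Let `g` be a continuous, increasing, concave function on `[0,∞)`
with `g(0) = 0` restricting to a bijection of `(0,∞)` onto itself, and let `β` be a
decreasing differentiable bijection of `(0,∞)` onto itself. With `V(t) = β(1/t)`,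
`D(x) = sup_{t>0} (t − (t/x) V(t))` and `D_{g,β}(x) = sup_{u>0} g(u)(1 − V(u)/x)`,
one has, for every `x > 0` and `ρ > 1`,
`(1 − ρ⁻¹) g(D(ρ⁻¹ x)) ≤ D_{g,β}(x) ≤ g(D(x))`. -/
theorem Dg_beta_comparison (g β : ℝ → ℝ)
    (hgc : ContinuousOn g (Ici 0))
    (hgm : StrictMonoOn g (Ici 0))
    (hgconc : ConcaveOn ℝ (Ici 0) g)
    (hg0 : g 0 = 0)
    (hgbij : BijOn g (Ioi 0) (Ioi 0))
    (hβanti : StrictAntiOn β (Ioi 0))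
    (hβdiff : ∀ t > (0 : ℝ), DifferentiableAt ℝ β t)
    (hβbij : BijOn β (Ioi 0) (Ioi 0)) :
    ∀ x > (0 : ℝ), ∀ ρ > (1 : ℝ),
      (1 - ρ⁻¹) *
          g (sSup {y : ℝ | ∃ t > (0 : ℝ), y = t - t / (ρ⁻¹ * x) * β (1 / t)}) ≤
        sSup {y : ℝ | ∃ u > (0 : ℝ), y = g u * (1 - β (1 / u) / x)} ∧
      sSup {y : ℝ | ∃ u > (0 : ℝ), y = g u * (1 - β (1 / u) / x)} ≤
        g (sSup {y : ℝ | ∃ t > (0 : ℝ), y = t - t / x * β (1 / t)}) := by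
  have key : ∀ x > (0 : ℝ), ∃ T > (0 : ℝ), β (1 / T) = x ∧
      ∀ t > (0 : ℝ), (t < T → 0 < 1 - β (1 / t) / x) ∧ (T ≤ t → 1 - β (1 / t) / x ≤ 0) := by
    intro x hx
    obtain ⟨a, ha, hax⟩ := hβbij.surjOn (show x ∈ Ioi (0 : ℝ) from hx)
    have ha' : (0 : ℝ) < a := ha
    refine ⟨1 / a, by positivity, by simpa using hax, ?_⟩
    intro t ht
    have h1 : (0 : ℝ) < 1 / t := by positivity
    constructor
    · intro h
      have h2 : a < 1 / t := by
        rw [lt_div_iff₀ ht]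
        rw [lt_div_iff₀ ha'] at h
        linarith
      have h3 := hβanti ha (show 1 / t ∈ Ioi (0 : ℝ) from h1) h2
      rw [hax] at h3
      rw [sub_pos, div_lt_one hx]
      exact h3
    · intro h
      have h2 : 1 / t ≤ a := by
        rw [div_le_iff₀ ht]
        rw [div_le_iff₀ ha'] at h
        linarith
      have h3 := hβanti.antitoneOn (show 1 / t ∈ Ioi (0 : ℝ) from h1) ha h2
      rw [hax] at h3
      rw [sub_nonpos, le_div_iff₀ hx]
      linarith
  have hβpos : ∀ t > (0 : ℝ), 0 < β (1 / t) := fun t ht =>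
    hβbij.mapsTo (show 1 / t ∈ Ioi (0 : ℝ) from one_div_pos.mpr ht)
  have hgpos : ∀ t > (0 : ℝ), 0 < g t := fun t ht => hgbij.mapsTo (show t ∈ Ioi (0 : ℝ) from ht)
  have lam : ∀ x > (0 : ℝ), ∀ t > (0 : ℝ), 1 - β (1 / t) / x ≤ 1 := by
    intro x hx t ht
    have := div_pos (hβpos t ht) hx
    linarith
  have eqn : ∀ x t : ℝ, t - t / x * β (1 / t) = t * (1 - β (1 / t) / x) := by
    intro x t
    ring
  -- upper bounds
  have bdF : ∀ x > (0 : ℝ), ∀ T > (0 : ℝ),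
      (∀ t > (0 : ℝ), (t < T → 0 < 1 - β (1 / t) / x) ∧ (T ≤ t → 1 - β (1 / t) / x ≤ 0)) →
      ∀ y ∈ {y : ℝ | ∃ t > (0 : ℝ), y = t - t / x * β (1 / t)}, y ≤ T := by
    rintro x hx T hT h y ⟨t, ht, rfl⟩
    rw [eqn]
    have := lam x hx t ht
    rcases lt_or_ge t T with h1 | h1
    · nlinarith
    · have := (h t ht).2 h1
      nlinarith
  have Dpos : ∀ x > (0 : ℝ), 0 < sSup {y : ℝ | ∃ t > (0 : ℝ), y = t - t / x * β (1 / t)} := by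
    intro x hx
    obtain ⟨T, hT, -, h⟩ := key x hx
    have h2 : T / 2 > 0 := by positivity
    have h3 := (h (T / 2) h2).1 (by linarith)
    refine lt_of_lt_of_le (mul_pos h2 h3) ?_
    rw [← eqn]
    exact le_csSup ⟨T, bdF x hx T hT h⟩ ⟨T / 2, h2, rfl⟩
  have up : ∀ x > (0 : ℝ), ∀ y ∈ {y : ℝ | ∃ u > (0 : ℝ), y = g u * (1 - β (1 / u) / x)},
      y ≤ g (sSup {y : ℝ | ∃ t > (0 : ℝ), y = t - t / x * β (1 / t)}) := by
    rintro x hx y ⟨u, hu, rfl⟩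
    obtain ⟨T, hT, -, h⟩ := key x hx
    have hD := Dpos x hx
    rcases lt_or_ge u T with h1 | h1
    · have h2 := (h u hu).1 h1
      have h3 := lam x hx u hu
      have h4 := hgconc.2 (show u ∈ Ici (0 : ℝ) from hu.le) (show (0 : ℝ) ∈ Ici (0 : ℝ) from self_mem_Ici)
        h2.le (sub_nonneg.mpr h3) (by ring)
      simp only [smul_eq_mul, hg0, mul_zero, add_zero] at h4
      rw [mul_comm]
      refine h4.trans (hgm.monotoneOn (mul_pos h2 hu).le hD.le ?_)
      rw [mul_comm, ← eqn]
      exact le_csSup ⟨T, bdF x hx T hT h⟩ ⟨u, hu, rfl⟩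
    · have h2 := (h u hu).2 h1
      have h3 := hgpos u hu
      have h4 := hgpos _ hD
      nlinarith
  intro x hx ρ hρ
  have hρ0 : 0 < ρ := by linarith
  constructor
  · have hx' : 0 < ρ⁻¹ * x := by positivity
    obtain ⟨T, hT, hTx, h⟩ := key _ hx'
    have h1 : sSup {y : ℝ | ∃ t > (0 : ℝ), y = t - t / (ρ⁻¹ * x) * β (1 / t)} ≤ T :=
      csSup_le ⟨_, 1, one_pos, rfl⟩ (bdF _ hx' T hT h)
    have h2 := hgm.monotoneOn (Dpos _ hx').le hT.le h1
    have h3 : ρ⁻¹ < 1 := inv_lt_one_of_one_lt₀ hρ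
    refine (mul_le_mul_of_nonneg_left h2 (by linarith)).trans ?_
    refine le_csSup ⟨_, up x hx⟩ ⟨T, hT, ?_⟩
    rw [hTx, mul_div_assoc, div_self hx.ne', mul_one, mul_comm]
  · exact csSup_le ⟨_, 1, one_pos, rfl⟩ (up x hx)
end

section
/- For every unit vector f ∈ H (‖f‖ = 1), one has Ψ( (Af, f) ) ≤ ( Ψ(A)f, f ), where (Af, f) denotes the (real) inner product of Af with f and Ψ(A) is obtained from A by the continuous functional calculus for the self-adjoint operator A. -/
open scoped ComplexInnerProductSpace

theorem exists_support_line (Ψ : ℝ → ℝ) (h : ConvexOn ℝ Set.univ Ψ) (t : ℝ) :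
    ∃ c : ℝ, ∀ x, Ψ t + c * (x - t) ≤ Ψ x := by
  refine ⟨derivWithin Ψ (Set.Ioi t) t, fun x => ?_⟩
  have hi : ∀ y : ℝ, y ∈ interior (Set.univ : Set ℝ) := by simp
  rcases lt_trichotomy x t with hx | hx | hx
  · have h1 := h.slope_le_leftDeriv_of_mem_interior (Set.mem_univ x) (hi t) hx
    have h2 := h.leftDeriv_le_rightDeriv_of_mem_interior (hi t)
    have h3 := h1.trans h2
    rw [slope_def_field, div_le_iff₀ (by linarith)] at h3
    linarith
  · simp [hx]
  · have h1 := h.rightDeriv_le_slope_of_mem_interior (hi t) (Set.mem_univ x) hx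
    rw [slope_def_field, le_div_iff₀ (by linarith)] at h1
    linarith

/-- Let `H` be a complex Hilbert space, `A` a bounded self-adjoint
operator on `H`, and `Ψ : ℝ → ℝ` a continuous convex function. Then for every unit
vector `f ∈ H`, Jensen's inequality `Ψ((Af, f)) ≤ (Ψ(A) f, f)` holds, where `Ψ(A)`
is given by the continuous functional calculus and `(·,·)` is interpreted via the
real part of the inner product (which is real for self-adjoint `A`). -/
theorem jensen_functional_calculus
    {H : Type*} [NormedAddCommGroup H] [InnerProductSpace ℂ H] [CompleteSpace H]
    (A : H →L[ℂ] H) (hA : IsSelfAdjoint A)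
    (Ψ : ℝ → ℝ) (hΨc : Continuous Ψ) (hΨconv : ConvexOn ℝ Set.univ Ψ) :
    ∀ f : H, ‖f‖ = 1 → Ψ (⟪A f, f⟫.re) ≤ (⟪(cfc Ψ A) f, f⟫).re := by
  intro f hf
  obtain ⟨c, hc⟩ := exists_support_line Ψ hΨconv (⟪A f, f⟫.re)
  set t := ⟪A f, f⟫.re with ht
  have hle : cfc (fun x : ℝ => (Ψ t - c * t) + c * x) A ≤ cfc Ψ A := by
    refine cfc_mono (fun x _ => ?_) (by fun_prop) hΨc.continuousOn
    have := hc x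
    linarith
  have heq : cfc (fun x : ℝ => (Ψ t - c * t) + c * x) A
      = algebraMap ℝ (H →L[ℂ] H) (Ψ t - c * t) + c • A := by
    rw [cfc_const_add (Ψ t - c * t) (fun x : ℝ => c * x) A, cfc_const_mul_id c A]
  rw [heq, ContinuousLinearMap.le_def] at hle
  have hpos := hle.re_inner_nonneg_left f
  have hff : ⟪f, f⟫ = (1 : ℂ) := by
    rw [inner_self_eq_norm_sq_to_K, hf]; simp
  rw [Algebra.algebraMap_eq_smul_one] at hpos
  simp only [ContinuousLinearMap.sub_apply, ContinuousLinearMap.add_apply,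
    ContinuousLinearMap.smul_apply, ContinuousLinearMap.one_apply, inner_sub_left,
    inner_add_left, inner_smul_left_eq_star_smul, hff] at hpos
  simp [← ht] at hpos
  linarith
end
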